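/- arXiv:2402.16231 — 4 statements merged into one kernel-verified Lean document; each statement's English description precedes it below -/
import Mathlib

section
/- Let ℓ and p be distinct prime numbers and let n ≥ 1. Then the second group cohomology H²(SL₂(ℤ/ℓℤ), ℤ/pⁿℤ), with ℤ/pⁿℤ carrying the trivial SL₂(ℤ/ℓℤ)-action, vanishes. -/
namespace SteinbergSL2

variable {F E : Type*} [Field F] [Group E]

/-- The Weyl element attached to a pair of root subgroups. -/
def W (X Y : F → E) (t : F) : E := X t * Y (-t⁻¹) * X t

/-- The torus element attached to a pair of root subgroups. -/
def H (X Y : F → E) (t : F) : E := W X Y t * W X Y (-1)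

/-- Steinberg relations of type `A₁`, with commuting torus elements. -/
structure Rel (X Y : F → E) : Prop where
  xadd : ∀ s t, X s * X t = X (s + t)
  yadd : ∀ s t, Y s * Y t = Y (s + t)
  wx : ∀ t u, t ≠ 0 → W X Y t * X u = Y (-(t⁻¹ ^ 2 * u)) * W X Y t
  wy : ∀ t u, t ≠ 0 → W X Y t * Y u = X (-(t ^ 2 * u)) * W X Y t
  hcomm : ∀ a b, a ≠ 0 → b ≠ 0 → H X Y a * H X Y b = H X Y b * H X Y a

namespace Rel
variable {X Y : F → E} (S : Rel X Y)
include S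

theorem x0 : X 0 = 1 := by
  have h := S.xadd 0 0
  rw [add_zero] at h
  exact mul_eq_left.mp h

theorem y0 : Y 0 = 1 := by
  have h := S.yadd 0 0
  rw [add_zero] at h
  exact mul_eq_left.mp h

theorem xadd' (s t : F) (e : E) : X s * (X t * e) = X (s + t) * e := by
  rw [← mul_assoc, S.xadd]

theorem yadd' (s t : F) (e : E) : Y s * (Y t * e) = Y (s + t) * e := by
  rw [← mul_assoc, S.yadd]

theorem wneg (t : F) : W X Y t * W X Y (-t) = 1 := by
  simp [W, mul_assoc, S.xadd', S.yadd', S.x0, S.y0, S.xadd]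

theorem wneg' (t : F) : W X Y (-t) * W X Y t = 1 := by
  simpa using S.wneg (-t)

theorem wyxy (t : F) (ht : t ≠ 0) : W X Y t = Y (-t⁻¹) * X t * Y (-t⁻¹) := by
  have h := S.wx t t ht
  have e : -(t⁻¹ ^ 2 * t) = -t⁻¹ := by field_simp
  rw [e] at h
  apply mul_right_cancel (b := X t)
  rw [h, W]
  simp only [mul_assoc]

theorem ww (a t : F) (ha : a ≠ 0) (ht : t ≠ 0) :
    W X Y a * W X Y t = W X Y (a ^ 2 / t) * W X Y a := by
  have h0 : a ^ 2 / t ≠ 0 := div_ne_zero (pow_ne_zero _ ha) ht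
  rw [S.wyxy _ h0]
  conv_lhs => rw [W.eq_1 X Y t, ← mul_assoc, ← mul_assoc, S.wx _ _ ha, mul_assoc (Y _), S.wy _ _ ha,
    mul_assoc, mul_assoc, S.wx _ _ ha]
  have e1 : -(a⁻¹ ^ 2 * t) = -(a ^ 2 / t)⁻¹ := by field_simp
  have e2 : -(a ^ 2 * -t⁻¹) = a ^ 2 / t := by field_simp
  rw [e1, e2]
  simp only [mul_assoc]

theorem hw (a t : F) (ha : a ≠ 0) (ht : t ≠ 0) :
    H X Y a * W X Y t = W X Y (a ^ 2 * t) * H X Y a := by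
  have h1 : (-1 : F) ≠ 0 := neg_ne_zero.mpr one_ne_zero
  rw [H, mul_assoc, S.ww _ _ h1 ht, ← mul_assoc, S.ww _ _ ha (div_ne_zero (by simp) ht), mul_assoc]
  congr 2
  field_simp

theorem hx (a u : F) (ha : a ≠ 0) :
    H X Y a * X u = X (a ^ 2 * u) * H X Y a := by
  have h1 : (-1 : F) ≠ 0 := neg_ne_zero.mpr one_ne_zero
  rw [H, mul_assoc, S.wx _ _ h1, ← mul_assoc, S.wy _ _ ha, mul_assoc]
  congr 2
  field_simp

/-- Multiplicativity when one argument is a square. -/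
theorem hsq (a t : F) (ha : a ≠ 0) (ht : t ≠ 0) :
    H X Y t * H X Y (a ^ 2) = H X Y (a ^ 2 * t) := by
  have h1 : (-1 : F) ≠ 0 := neg_ne_zero.mpr one_ne_zero
  have h := S.hcomm a t ha ht
  conv_lhs at h => rw [H.eq_1 X Y t, ← mul_assoc, S.hw a t ha ht, mul_assoc, S.hw a _ ha h1,
    ← mul_assoc]
  have h2 := mul_right_cancel h
  rw [← h2, H, H, mul_neg_one, mul_assoc, ← mul_assoc (W X Y (-a ^ 2)), S.wneg', one_mul]

/-- The Steinberg symbol relation. -/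
theorem wsymb (t u : F) (ht : t ≠ 0) (hu : u ≠ 0) (htu : t + u = 1) :
    W X Y t * W X Y (-1) * W X Y u = W X Y (t * u) := by
  have hu' : u = 1 - t := by rw [← htu]; ring
  have htu0 : t * u ≠ 0 := mul_ne_zero ht hu
  have ht2 : t ^ 2 ≠ 0 := pow_ne_zero _ ht
  -- product of two Weyl elements
  have hW2 : W X Y t * W X Y u
      = Y (-t⁻¹) * X (t ^ 2) * W X Y (t * u) * X (u ^ 2) * Y (-u⁻¹) := by
    have e1 : -t⁻¹ + -u⁻¹ = -(t * u)⁻¹ := by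
      field_simp; rw [← htu]; ring
    have e2 : t ^ 2 + t * u = t := by rw [hu']; ring
    have e3 : t * u + u ^ 2 = u := by rw [hu']; ring
    rw [S.wyxy t ht, S.wyxy u hu, W]
    simp only [mul_assoc]
    rw [S.yadd', S.xadd', S.xadd', e1, e2, e3]
  -- expand the middle
  have hA : W X Y t * W X Y (-1) * W X Y u
      = Y (t⁻¹ ^ 2) * X (-t ^ 2) * (W X Y t * W X Y u) * Y (u⁻¹ ^ 2) := by
    have e1 : X (-1) * W X Y u = W X Y u * Y (u⁻¹ ^ 2) := by
      rw [S.wy u _ hu]; congr 2; field_simp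
    have e2 : W X Y t * X (-1) = Y (t⁻¹ ^ 2) * W X Y t := by
      rw [S.wx t _ ht]; congr 2; field_simp
    have e3 : W X Y t * Y 1 = X (-t ^ 2) * W X Y t := by
      rw [S.wy t _ ht, mul_one]
    calc _ = (W X Y t * X (-1)) * Y 1 * (X (-1) * W X Y u) := by
          rw [W.eq_1 X Y (-1)]; simp [mul_assoc]
      _ = Y (t⁻¹ ^ 2) * (W X Y t * Y 1) * (W X Y u * Y (u⁻¹ ^ 2)) := by
          rw [e1, e2]; simp only [mul_assoc]
      _ = _ := by rw [e3]; simp only [mul_assoc]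
  have hB : W X Y (t * u) * X (u ^ 2) * Y (-u⁻¹) * Y (u⁻¹ ^ 2)
      = Y (-(t ^ 2)⁻¹) * X (-t ^ 3) * W X Y (t * u) := by
    rw [mul_assoc, S.yadd, S.wx _ _ htu0, mul_assoc, S.wy _ _ htu0, ← mul_assoc]
    congr 3
    · field_simp
    · have : -u⁻¹ + u⁻¹ ^ 2 = t * u⁻¹ ^ 2 := by
        field_simp; rw [← htu]; ring
      rw [this]; field_simp
  have hC : Y (t⁻¹ ^ 2) * X (-t ^ 2) = X (t ^ 2) * W X Y (-t ^ 2) := by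
    rw [W]
    simp only [mul_assoc]
    rw [S.xadd']
    simp [S.x0]
  have hD : X (t ^ 2) * Y (-(t ^ 2)⁻¹) = W X Y (t ^ 2) * X (-t ^ 2) := by
    rw [W]
    simp only [mul_assoc]
    rw [S.xadd]
    simp [S.x0]
  have hE : W X Y (-t ^ 2) * Y (-t⁻¹) * W X Y (t ^ 2) = X (t ^ 3) := by
    rw [S.wy _ _ (neg_ne_zero.mpr ht2), mul_assoc, S.wneg', mul_one]
    congr 1; field_simp
  calc _ = Y (t⁻¹ ^ 2) * X (-t ^ 2) * Y (-t⁻¹) * X (t ^ 2) *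
        (W X Y (t * u) * X (u ^ 2) * Y (-u⁻¹) * Y (u⁻¹ ^ 2)) := by
        rw [hA, hW2]; simp only [mul_assoc]
    _ = (Y (t⁻¹ ^ 2) * X (-t ^ 2)) * Y (-t⁻¹) * (X (t ^ 2) * Y (-(t ^ 2)⁻¹)) *
        X (-t ^ 3) * W X Y (t * u) := by rw [hB]; simp only [mul_assoc]
    _ = X (t ^ 2) * (W X Y (-t ^ 2) * Y (-t⁻¹) * W X Y (t ^ 2)) * X (-t ^ 2) * X (-t ^ 3)
          * W X Y (t * u) := by
        rw [hC, hD]; simp only [mul_assoc]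
    _ = W X Y (t * u) := by
        rw [hE, S.xadd, S.xadd, S.xadd]
        have : t ^ 2 + t ^ 3 + -t ^ 2 + -t ^ 3 = 0 := by ring
        rw [this, S.x0, one_mul]

theorem hsymb (t u : F) (ht : t ≠ 0) (hu : u ≠ 0) (htu : t + u = 1) :
    H X Y t * H X Y u = H X Y (t * u) := by
  rw [H, H, H, ← S.wsymb t u ht hu htu]
  simp only [mul_assoc]

/-- Full multiplicativity of the torus lift. -/
theorem hmul (hF : ∀ s t : F, ¬ IsSquare s → ¬ IsSquare t → ∃ a, s = a ^ 2 * t)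
    (hF2 : ∀ x : F, ∃ a b, a ^ 2 + b ^ 2 = x)
    (t u : F) (ht : t ≠ 0) (hu : u ≠ 0) :
    H X Y t * H X Y u = H X Y (t * u) := by
  by_cases hus : IsSquare u
  · obtain ⟨a, rfl⟩ := hus
    have ha : a ≠ 0 := left_ne_zero_of_mul hu
    rw [← pow_two, S.hsq a t ha ht, mul_comm]
  by_cases hts : IsSquare t
  · obtain ⟨a, rfl⟩ := hts
    have ha : a ≠ 0 := left_ne_zero_of_mul ht
    rw [S.hcomm _ _ ht hu, ← pow_two, S.hsq a u ha hu]
  obtain ⟨a, b, hab⟩ := hF2 t⁻¹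
  have ha : a ≠ 0 := by
    rintro rfl
    apply hts
    refine ⟨b⁻¹, ?_⟩
    rw [← inv_inv t, ← hab]
    simp [pow_two]
  have hb : b ≠ 0 := by
    rintro rfl
    apply hts
    refine ⟨a⁻¹, ?_⟩
    rw [← inv_inv t, ← hab]
    simp [pow_two]
  obtain ⟨c, hc⟩ := hF u t hus hts
  have hc0 : c ≠ 0 := by rintro rfl; simp [hc] at hu
  -- `v = a² t` and `w = b² t` satisfy `v + w = 1`
  have hv : a ^ 2 * t ≠ 0 := mul_ne_zero (pow_ne_zero _ ha) ht
  have hw : b ^ 2 * t ≠ 0 := mul_ne_zero (pow_ne_zero _ hb) ht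
  have hs := S.hsymb _ _ hv hw (by rw [← add_mul, hab, inv_mul_cancel₀ ht])
  have hab0 : a * b ≠ 0 := mul_ne_zero ha hb
  have htt : t * t ≠ 0 := mul_ne_zero ht ht
  have e : a ^ 2 * t * (b ^ 2 * t) = (a * b) ^ 2 * (t * t) := by ring
  have e2 : H X Y (a ^ 2) * H X Y (b ^ 2) = H X Y ((a * b) ^ 2) := by
    rw [S.hsq b _ hb (pow_ne_zero _ ha)]; congr 1; ring
  have htt' : H X Y t * H X Y t = H X Y (t * t) := by
    rw [e, ← S.hsq (a * b) _ hab0 htt, ← S.hsq a t ha ht, ← S.hsq b t hb ht, ← e2] at hs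
    have h3 : H X Y t * H X Y (a ^ 2) * (H X Y t * H X Y (b ^ 2))
        = H X Y t * H X Y t * (H X Y (a ^ 2) * H X Y (b ^ 2)) := by
      rw [mul_assoc, ← mul_assoc (H X Y (a ^ 2)), S.hcomm _ _ (pow_ne_zero _ ha) ht]
      simp only [mul_assoc]
    rw [h3] at hs
    exact mul_right_cancel hs
  have e3 : t * u = c ^ 2 * (t * t) := by rw [hc]; ring
  rw [e3, ← S.hsq c _ hc0 htt, ← htt', hc, ← S.hsq c t hc0 ht, mul_assoc]

end Rel
end SteinbergSL2

namespace SteinbergSL2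
open Matrix

/-- Upper unipotent matrix. -/
def mx {F : Type*} [Field F] (t : F) : SpecialLinearGroup (Fin 2) F :=
  ⟨!![1, t; 0, 1], by simp [Matrix.det_fin_two]⟩

/-- Lower unipotent matrix. -/
def my {F : Type*} [Field F] (t : F) : SpecialLinearGroup (Fin 2) F :=
  ⟨!![1, 0; t, 1], by simp [Matrix.det_fin_two]⟩

/-- Weyl matrix. -/
def mw {F : Type*} [Field F] (t : F) (ht : t ≠ 0) : SpecialLinearGroup (Fin 2) F :=
  ⟨!![0, t; -t⁻¹, 0], by simp [Matrix.det_fin_two, ht]⟩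

/-- Torus matrix. -/
def mh {F : Type*} [Field F] (t : F) (ht : t ≠ 0) : SpecialLinearGroup (Fin 2) F :=
  ⟨!![t, 0; 0, t⁻¹], by simp [Matrix.det_fin_two, ht]⟩

theorem sl_ext {F : Type*} [Field F] {A B : SpecialLinearGroup (Fin 2) F}
    (h00 : A 0 0 = B 0 0) (h01 : A 0 1 = B 0 1) (h10 : A 1 0 = B 1 0) (h11 : A 1 1 = B 1 1) :
    A = B := by
  apply Matrix.SpecialLinearGroup.ext
  intro i j
  fin_cases i <;> fin_cases j <;> assumption

theorem mul_apply2 {F : Type*} [Field F] (A B : SpecialLinearGroup (Fin 2) F) (i j : Fin 2) :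
    (A * B) i j = A i 0 * B 0 j + A i 1 * B 1 j := by
  rw [Matrix.SpecialLinearGroup.coe_mul, Matrix.mul_apply, Fin.sum_univ_two]

theorem det2 {F : Type*} [Field F] (A : SpecialLinearGroup (Fin 2) F) :
    A 0 0 * A 1 1 - A 0 1 * A 1 0 = 1 := by
  rw [← Matrix.det_fin_two, A.det_coe]

section entries
variable {F : Type*} [Field F] (t : F) (ht : t ≠ 0)
@[simp] theorem mx00 : (mx t) 0 0 = 1 := rfl
@[simp] theorem mx01 : (mx t) 0 1 = t := rfl
@[simp] theorem mx10 : (mx t) 1 0 = 0 := rfl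
@[simp] theorem mx11 : (mx t) 1 1 = 1 := rfl
@[simp] theorem my00 : (my t) 0 0 = 1 := rfl
@[simp] theorem my01 : (my t) 0 1 = 0 := rfl
@[simp] theorem my10 : (my t) 1 0 = t := rfl
@[simp] theorem my11 : (my t) 1 1 = 1 := rfl
@[simp] theorem mw00 : (mw t ht) 0 0 = 0 := rfl
@[simp] theorem mw01 : (mw t ht) 0 1 = t := rfl
@[simp] theorem mw10 : (mw t ht) 1 0 = -t⁻¹ := rfl
@[simp] theorem mw11 : (mw t ht) 1 1 = 0 := rfl
@[simp] theorem mh00 : (mh t ht) 0 0 = t := rfl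
@[simp] theorem mh01 : (mh t ht) 0 1 = 0 := rfl
@[simp] theorem mh10 : (mh t ht) 1 0 = 0 := rfl
@[simp] theorem mh11 : (mh t ht) 1 1 = t⁻¹ := rfl
end entries

variable {F E : Type*} [Field F] [Group E]

namespace Rel
variable {X Y : F → E} (S : Rel X Y)
  (hm : ∀ t u : F, t ≠ 0 → u ≠ 0 → H X Y t * H X Y u = H X Y (t * u))
include S

theorem w_eq (q : F) : W X Y q = H X Y q * W X Y 1 := by
  rw [H, mul_assoc, S.wneg', mul_one]

theorem w1h (a : F) (ha : a ≠ 0) : W X Y 1 * H X Y a = H X Y a⁻¹ * W X Y 1 := by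
  rw [← S.w_eq, H, ← mul_assoc, S.ww _ _ one_ne_zero ha, mul_assoc, S.wneg, mul_one]
  congr 1
  field_simp

include hm

theorem wh (q a : F) (hq : q ≠ 0) (ha : a ≠ 0) : W X Y q * H X Y a = W X Y (q / a) := by
  rw [S.w_eq, mul_assoc, S.w1h a ha, ← mul_assoc, hm _ _ hq (inv_ne_zero ha), ← S.w_eq,
    div_eq_mul_inv]

theorem hW (q a : F) (hq : q ≠ 0) (ha : a ≠ 0) : H X Y a * W X Y q = W X Y (a * q) := by
  rw [S.w_eq q, ← mul_assoc, hm _ _ ha hq, ← S.w_eq]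

theorem wwh (q r : F) (hq : q ≠ 0) (hr : r ≠ 0) : W X Y q * W X Y r = H X Y (-q / r) := by
  have h : W X Y q = H X Y (-q / r) * W X Y (-r) := by
    rw [S.hW hm _ _ (neg_ne_zero.mpr hr) (div_ne_zero (neg_ne_zero.mpr hq) hr)]
    congr 1
    field_simp
  rw [h, mul_assoc, S.wneg', mul_one]

/-- The case of three Weyl elements. -/
theorem wxw (q p r : F) (hq : q ≠ 0) (hp : p ≠ 0) (hr : r ≠ 0) :
    W X Y q * X p * W X Y r = X (-(q ^ 2 / p)) * W X Y (-(q * r / p)) * X (-(r ^ 2 / p)) := by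
  have e1 : X p = Y p⁻¹ * W X Y p * Y p⁻¹ := by
    rw [S.wyxy p hp]
    simp only [mul_assoc, S.yadd', S.yadd]
    simp [S.y0]
  have e2 : Y p⁻¹ * W X Y r = W X Y r * X (-(r ^ 2 / p)) := by
    rw [S.wx _ _ hr]
    congr 2
    field_simp
  have e3 : W X Y q * Y p⁻¹ = X (-(q ^ 2 / p)) * W X Y q := by
    rw [S.wy _ _ hq, div_eq_mul_inv]
  calc _ = (W X Y q * Y p⁻¹) * W X Y p * (Y p⁻¹ * W X Y r) := by
        rw [e1]; simp only [mul_assoc]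
    _ = X (-(q ^ 2 / p)) * (W X Y q * W X Y p * W X Y r) * X (-(r ^ 2 / p)) := by
        rw [e2, e3]; simp only [mul_assoc]
    _ = _ := by
        rw [S.wwh hm q p hq hp, S.hW hm _ _ hr (div_ne_zero (neg_ne_zero.mpr hq) hp)]
        congr 3
        field_simp

end Rel

open Classical in
/-- The Bruhat section. -/
noncomputable def sec (X Y : F → E) (g : SpecialLinearGroup (Fin 2) F) : E :=
  if g 1 0 = 0 then X (g 0 0 * g 0 1) * H X Y (g 0 0)
  else X (g 0 0 / g 1 0) * W X Y (-(g 1 0)⁻¹) * X (g 1 1 / g 1 0)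

section
variable {X Y : F → E} (S : Rel X Y)
  (hm : ∀ t u : F, t ≠ 0 → u ≠ 0 → H X Y t * H X Y u = H X Y (t * u))
  (π : E →* SpecialLinearGroup (Fin 2) F) (hX : ∀ t, π (X t) = mx t) (hY : ∀ t, π (Y t) = my t)

theorem sec_of_eq {g : SpecialLinearGroup (Fin 2) F} (h : g 1 0 = 0) :
    sec X Y g = X (g 0 0 * g 0 1) * H X Y (g 0 0) := if_pos h

theorem sec_of_ne {g : SpecialLinearGroup (Fin 2) F} (h : g 1 0 ≠ 0) :
    sec X Y g = X (g 0 0 / g 1 0) * W X Y (-(g 1 0)⁻¹) * X (g 1 1 / g 1 0) := if_neg h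

include hX hY in
theorem pi_w (t : F) (ht : t ≠ 0) : π (W X Y t) = mw t ht := by
  rw [W, map_mul, map_mul, hX, hY]
  apply sl_ext <;> simp [mul_apply2, ht]

include hX hY in
theorem pi_h (t : F) (ht : t ≠ 0) : π (H X Y t) = mh t ht := by
  rw [H, map_mul, pi_w π hX hY t ht, pi_w π hX hY (-1) (by simp)]
  apply sl_ext <;> simp [mul_apply2]

include hX hY in
theorem pi_sec (g : SpecialLinearGroup (Fin 2) F) : π (sec X Y g) = g := by
  have hd := det2 g
  by_cases h : g 1 0 = 0
  · rw [h, mul_zero, sub_zero] at hd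
    have h0 : g 0 0 ≠ 0 := left_ne_zero_of_mul_eq_one hd
    have h1 : (g 0 0)⁻¹ = g 1 1 := inv_eq_of_mul_eq_one_right hd
    rw [sec_of_eq h, map_mul, hX, pi_h π hX hY _ h0]
    apply sl_ext <;> simp [mul_apply2, h, h1]
    rw [mul_right_comm, hd, one_mul]
  · have h' : -(g 1 0)⁻¹ ≠ 0 := by simpa using h
    rw [sec_of_ne h, map_mul, map_mul, hX, hX, pi_w π hX hY _ h']
    apply sl_ext <;> simp [mul_apply2, h]
    · field_simp
      linear_combination hd
    · field_simp

include S in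
theorem x_sec (t : F) (g : SpecialLinearGroup (Fin 2) F) :
    X t * sec X Y g = sec X Y (mx t * g) := by
  have hd := det2 g
  have e10 : (mx t * g) 1 0 = g 1 0 := by simp [mul_apply2]
  have e00 : (mx t * g) 0 0 = g 0 0 + t * g 1 0 := by simp [mul_apply2]
  have e01 : (mx t * g) 0 1 = g 0 1 + t * g 1 1 := by simp [mul_apply2]
  have e11 : (mx t * g) 1 1 = g 1 1 := by simp [mul_apply2]
  by_cases h : g 1 0 = 0
  · rw [sec_of_eq h, sec_of_eq (e10.trans h), ← mul_assoc, S.xadd, e00, e01]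
    rw [h] at hd ⊢
    simp only [mul_zero, add_zero]
    congr 2
    linear_combination -t * hd
  · rw [sec_of_ne h, sec_of_ne (by rwa [e10]), ← mul_assoc, ← mul_assoc, S.xadd, e00, e10, e11]
    congr 3
    field_simp
    ring

include S hm in
theorem w_sec (q : F) (hq : q ≠ 0) (g : SpecialLinearGroup (Fin 2) F) :
    W X Y q * sec X Y g = sec X Y (mw q hq * g) := by
  have hd := det2 g
  have e00 : (mw q hq * g) 0 0 = q * g 1 0 := by simp [mul_apply2]
  have e01 : (mw q hq * g) 0 1 = q * g 1 1 := by simp [mul_apply2]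
  have e10 : (mw q hq * g) 1 0 = -q⁻¹ * g 0 0 := by simp [mul_apply2]
  have e11 : (mw q hq * g) 1 1 = -q⁻¹ * g 0 1 := by simp [mul_apply2]
  by_cases h : g 1 0 = 0
  · rw [h, mul_zero, sub_zero] at hd
    have h0 : g 0 0 ≠ 0 := left_ne_zero_of_mul_eq_one hd
    have h10 : (mw q hq * g) 1 0 ≠ 0 := by
      rw [e10]; exact mul_ne_zero (neg_ne_zero.mpr (inv_ne_zero hq)) h0
    rw [sec_of_eq h, sec_of_ne h10, e00, e10, e11, h]
    have hx : X (g 0 0 * g 0 1) * H X Y (g 0 0) = H X Y (g 0 0) * X (g 0 1 / g 0 0) := by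
      rw [S.hx _ _ h0]; congr 2; field_simp
    rw [hx, ← mul_assoc, S.wh hm _ _ hq h0, mul_zero, zero_div, S.x0, one_mul]
    congr 2
    · field_simp
    · field_simp
  · have h' : -(g 1 0)⁻¹ ≠ 0 := by simpa using h
    by_cases ha : g 0 0 = 0
    · have h10 : (mw q hq * g) 1 0 = 0 := by rw [e10, ha, mul_zero]
      have hqc : q * g 1 0 ≠ 0 := mul_ne_zero hq h
      rw [sec_of_ne h, sec_of_eq h10, e00, e01, ha, zero_div, S.x0, one_mul, ← mul_assoc,
        S.wwh hm _ _ hq h']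
      have : -q / -(g 1 0)⁻¹ = q * g 1 0 := by field_simp
      rw [this, S.hx _ _ hqc]
      congr 2
      field_simp
    · have h10 : (mw q hq * g) 1 0 ≠ 0 := by
        rw [e10]; exact mul_ne_zero (neg_ne_zero.mpr (inv_ne_zero hq)) ha
      rw [sec_of_ne h, sec_of_ne h10, e00, e10, e11, ← mul_assoc, ← mul_assoc,
        S.wxw hm _ _ _ hq (div_ne_zero ha h) h', mul_assoc, S.xadd]
      congr 2
      · congr 1; field_simp
      · congr 1; field_simp
      · field_simp
        linear_combination hd

include S hm hX hY in
theorem sec_mul (g g' : SpecialLinearGroup (Fin 2) F) :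
    sec X Y g * sec X Y g' = sec X Y (g * g') := by
  have hPx : ∀ t k, X t * sec X Y k = sec X Y (π (X t) * k) := by
    intro t k; rw [hX, x_sec S]
  have hPw : ∀ t k, t ≠ 0 → W X Y t * sec X Y k = sec X Y (π (W X Y t) * k) := by
    intro t k ht; rw [pi_w π hX hY t ht, w_sec S hm]
  have key : ∀ k, sec X Y g * sec X Y k = sec X Y (π (sec X Y g) * k) := by
    intro k
    have hd := det2 g
    by_cases h : g 1 0 = 0
    · rw [h, mul_zero, sub_zero] at hd
      have h0 : g 0 0 ≠ 0 := left_ne_zero_of_mul_eq_one hd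
      rw [sec_of_eq h, H]
      simp only [map_mul, mul_assoc]
      rw [hPw _ _ (by simp), hPw _ _ h0, hPx]
    · have h' : -(g 1 0)⁻¹ ≠ 0 := by simpa using h
      rw [sec_of_ne h]
      simp only [map_mul, mul_assoc]
      rw [hPx, hPw _ _ h', hPx]
  rw [key, pi_sec π hX hY]

end
end SteinbergSL2

namespace SteinbergSL2
open Matrix

theorem mx_pow {F : Type*} [Field F] (t : F) (m : ℕ) : mx t ^ m = mx (m * t) := by
  induction m with
  | zero => apply sl_ext <;> simp
  | succ k ih =>
    rw [pow_succ, ih]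
    apply sl_ext <;> simp [mul_apply2]
    ring

theorem my_pow {F : Type*} [Field F] (t : F) (m : ℕ) : my t ^ m = my (m * t) := by
  induction m with
  | zero => apply sl_ext <;> simp
  | succ k ih =>
    rw [pow_succ, ih]
    apply sl_ext <;> simp [mul_apply2]
    ring

theorem mh_pow {F : Type*} [Field F] (t : F) (ht : t ≠ 0) (m : ℕ) :
    mh t ht ^ m = mh (t ^ m) (pow_ne_zero _ ht) := by
  induction m with
  | zero => apply sl_ext <;> simp
  | succ k ih =>
    rw [pow_succ, ih]
    apply sl_ext <;> simp [mul_apply2, pow_succ, mul_comm]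

theorem nonsq (ℓ : ℕ) [Fact ℓ.Prime] (s t : ZMod ℓ) (hs : ¬ IsSquare s) (ht : ¬ IsSquare t) :
    ∃ a, s = a ^ 2 * t := by
  have ht0 : t ≠ 0 := by rintro rfl; exact ht (IsSquare.zero)
  have hs0 : s ≠ 0 := by rintro rfl; exact hs (IsSquare.zero)
  have h2 : ringChar (ZMod ℓ) ≠ 2 := by
    intro h
    exact hs (FiniteField.isSquare_of_char_two h s)
  have h : quadraticChar (ZMod ℓ) (s * t) = 1 := by
    rw [map_mul, (quadraticChar_neg_one_iff_not_isSquare).2 hs,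
      (quadraticChar_neg_one_iff_not_isSquare).2 ht]
    norm_num
  obtain ⟨a, ha⟩ := (quadraticChar_one_iff_isSquare (mul_ne_zero hs0 ht0)).1 h
  refine ⟨a / t, ?_⟩
  field_simp
  rw [ha]
  ring

theorem splitting (ℓ : ℕ) [Fact ℓ.Prime] (N : ℕ) (hN : N.Coprime ℓ) {E : Type*} [Group E]
    (π : E →* SpecialLinearGroup (Fin 2) (ZMod ℓ)) (hsurj : Function.Surjective π)
    (hc : ∀ k, π k = 1 → ∀ e, k * e = e * k) (hk : ∀ k, π k = 1 → k ^ N = 1) :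
    ∃ s : SpecialLinearGroup (Fin 2) (ZMod ℓ) →* E, ∀ g, π (s g) = g := by
  obtain ⟨M, hM0, hM1⟩ := Nat.chineseRemainder hN 0 1
  have hMN : N ∣ M := (Nat.modEq_zero_iff_dvd).1 hM0
  have hMl : (M : ZMod ℓ) = 1 := by
    have := (ZMod.natCast_eq_natCast_iff M 1 ℓ).2 hM1
    simpa using this
  have hpow : ∀ e e' : E, π e = π e' → e ^ M = e' ^ M := by
    intro e e' h
    have hz : π (e'⁻¹ * e) = 1 := by rw [map_mul, map_inv, h, inv_mul_cancel]
    have hcm : Commute e' (e'⁻¹ * e) := (hc _ hz e').symm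
    have h1 : (e'⁻¹ * e) ^ M = 1 := by
      obtain ⟨c, rfl⟩ := hMN
      rw [pow_mul, hk _ hz, one_pow]
    calc e ^ M = (e' * (e'⁻¹ * e)) ^ M := by rw [mul_inv_cancel_left]
      _ = e' ^ M := by rw [hcm.mul_pow, h1, mul_one]
  set L := Function.surjInv hsurj with hL
  have hLr : ∀ g, π (L g) = g := Function.surjInv_eq hsurj
  let σ : SpecialLinearGroup (Fin 2) (ZMod ℓ) → E := fun g => L g ^ M
  have hσ : ∀ e, e ^ M = σ (π e) := fun e => hpow _ _ (hLr _).symm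
  have hconj : ∀ (e : E) (g g' : SpecialLinearGroup (Fin 2) (ZMod ℓ)), π e * g = g' * π e →
      e * σ g = σ g' * e := by
    intro e g g' h
    rw [← mul_inv_eq_iff_eq_mul]
    have : e * σ g * e⁻¹ = (e * L g * e⁻¹) ^ M := (conj_pow).symm
    rw [this, hσ, map_mul, map_mul, map_inv, hLr, h, mul_inv_cancel_right]
  let X : ZMod ℓ → E := fun t => σ (mx t)
  let Y : ZMod ℓ → E := fun t => σ (my t)
  have hX : ∀ t, π (X t) = mx t := by
    intro t
    change π (L (mx t) ^ M) = mx t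
    rw [map_pow, hLr, mx_pow, hMl, one_mul]
  have hY : ∀ t, π (Y t) = my t := by
    intro t
    change π (L (my t) ^ M) = my t
    rw [map_pow, hLr, my_pow, hMl, one_mul]
  have S : Rel X Y := by
    refine ⟨?_, ?_, ?_, ?_, ?_⟩
    · intro s t
      have h : ∀ m : ℕ, (L (mx 1) ^ m) ^ M = X (m : ZMod ℓ) := by
        intro m
        rw [hσ, map_pow, hLr, mx_pow, mul_one]
      rw [← ZMod.natCast_zmod_val s, ← ZMod.natCast_zmod_val t, ← Nat.cast_add, ← h, ← h, ← h,
        ← pow_mul, ← pow_mul, ← pow_mul, ← pow_add, add_mul]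
    · intro s t
      have h : ∀ m : ℕ, (L (my 1) ^ m) ^ M = Y (m : ZMod ℓ) := by
        intro m
        rw [hσ, map_pow, hLr, my_pow, mul_one]
      rw [← ZMod.natCast_zmod_val s, ← ZMod.natCast_zmod_val t, ← Nat.cast_add, ← h, ← h, ← h,
        ← pow_mul, ← pow_mul, ← pow_mul, ← pow_add, add_mul]
    · intro t u ht
      apply hconj
      rw [pi_w π hX hY t ht]
      apply sl_ext <;> simp [mul_apply2]
      field_simp
    · intro t u ht
      apply hconj
      rw [pi_w π hX hY t ht]
      apply sl_ext <;> simp [mul_apply2]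
      field_simp
    · intro a b ha hb
      obtain ⟨v, hv⟩ := IsCyclic.exists_monoid_generator (α := (ZMod ℓ)ˣ)
      have hv0 : (v : ZMod ℓ) ≠ 0 := v.ne_zero
      have h : ∀ a : ZMod ℓ, a ≠ 0 → ∃ (m : ℕ) (z : E), (∀ e, z * e = e * z) ∧
          H X Y a = L (mh v hv0) ^ m * z := by
        intro a ha
        obtain ⟨m, hm⟩ := Submonoid.mem_powers_iff _ _ |>.1 (hv (Units.mk0 a ha))
        have hm' : (v : ZMod ℓ) ^ m = a := by
          have := congrArg Units.val hm
          simpa using this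
        refine ⟨m, (L (mh v hv0) ^ m)⁻¹ * H X Y a, hc _ ?_, by rw [mul_inv_cancel_left]⟩
        rw [map_mul, map_inv, map_pow, hLr, mh_pow, pi_h π hX hY a ha]
        simp only [hm', inv_mul_cancel]
      obtain ⟨m, z, hz, hm⟩ := h a ha
      obtain ⟨m', z', hz', hm'⟩ := h b hb
      have c1 : Commute z z' := hz z'
      have c2 : ∀ k : ℕ, Commute (L (mh v hv0) ^ k) z := fun k => (hz _).symm
      have c3 : ∀ k : ℕ, Commute (L (mh v hv0) ^ k) z' := fun k => (hz' _).symm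
      rw [hm, hm']
      have c4 : Commute (L (mh v hv0) ^ m) (L (mh v hv0) ^ m') := Commute.pow_pow_self _ _ _
      exact ((c4.mul_right (c3 m)).mul_left ((c2 m').symm.mul_right c1))
  have hm := S.hmul (nonsq ℓ) (ZMod.sq_add_sq ℓ)
  exact ⟨MonoidHom.mk' (sec X Y) (fun g g' => (sec_mul S hm π hX hY g g').symm),
    pi_sec π hX hY⟩

/-- The central extension attached to a 2-cocycle. -/
@[ext]
structure CE {G A : Type*} (f : G → G → A) where
  a : A
  g : G

section
variable {G A : Type*} [Group G] [AddCommGroup A] {f : G → G → A}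

/-- The group structure on the central extension attached to a 2-cocycle. -/
@[reducible]
def ceGroup (hf : ∀ g h j, f (g * h) j + f g h = f h j + f g (h * j)) : Group (CE f) :=
  letI : Mul (CE f) := ⟨fun x y => ⟨x.a + y.a + f x.g y.g, x.g * y.g⟩⟩
  letI : One (CE f) := ⟨⟨-f 1 1, 1⟩⟩
  letI : Inv (CE f) := ⟨fun x => ⟨-x.a - f x.g⁻¹ x.g - f 1 1, x.g⁻¹⟩⟩
  Group.ofLeftAxioms
    (by
      intro x y z
      apply CE.ext
      · change x.a + y.a + f x.g y.g + z.a + f (x.g * y.g) z.g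
          = x.a + (y.a + z.a + f y.g z.g) + f x.g (y.g * z.g)
        have h := hf x.g y.g z.g
        rw [← sub_eq_zero] at h ⊢
        rw [← h]
        abel
      · exact mul_assoc x.g y.g z.g)
    (by
      intro x
      apply CE.ext
      · change -f 1 1 + x.a + f 1 x.g = x.a
        have h := hf 1 1 x.g
        simp only [one_mul] at h
        rw [add_right_inj] at h
        rw [h]
        abel
      · exact one_mul x.g)
    (by
      intro x
      apply CE.ext
      · change -x.a - f x.g⁻¹ x.g - f 1 1 + x.a + f x.g⁻¹ x.g = -f 1 1
        abel
      · exact inv_mul_cancel x.g)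

theorem cocycle_split (ℓ : ℕ) [Fact ℓ.Prime] (N : ℕ) (hN : N.Coprime ℓ)
    (hA : ∀ a : A, N • a = 0)
    (f : SpecialLinearGroup (Fin 2) (ZMod ℓ) → SpecialLinearGroup (Fin 2) (ZMod ℓ) → A)
    (hf : ∀ g h j, f (g * h) j + f g h = f h j + f g (h * j)) :
    ∃ b : SpecialLinearGroup (Fin 2) (ZMod ℓ) → A, ∀ g h, f g h = b h - b (g * h) + b g := by
  letI := ceGroup hf
  have mul_a : ∀ x y : CE f, (x * y).a = x.a + y.a + f x.g y.g := fun _ _ => rfl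
  have mul_g : ∀ x y : CE f, (x * y).g = x.g * y.g := fun _ _ => rfl
  have one_a : (1 : CE f).a = - f 1 1 := rfl
  have one_g : (1 : CE f).g = 1 := rfl
  have f1g : ∀ g, f 1 g = f 1 1 := by
    intro g
    have h := hf 1 1 g
    simp only [one_mul] at h
    exact (add_left_cancel h).symm
  have fg1 : ∀ g, f g 1 = f 1 1 := by
    intro g
    have h := hf g 1 1
    simp only [mul_one] at h
    exact add_right_cancel h
  let π : CE f →* SpecialLinearGroup (Fin 2) (ZMod ℓ) :=
    { toFun := CE.g, map_one' := rfl, map_mul' := fun _ _ => rfl }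
  obtain ⟨s, hs⟩ := splitting ℓ N hN π (fun g => ⟨⟨0, g⟩, rfl⟩)
    (by
      intro k hk e
      have hk' : k.g = 1 := hk
      apply CE.ext
      · rw [mul_a, mul_a, hk', f1g e.g, fg1 e.g, add_comm k.a]
      · rw [mul_g, mul_g, hk', one_mul, mul_one])
    (by
      intro k hk
      have hk' : k.g = 1 := hk
      have hg : ∀ m : ℕ, (k ^ m).g = 1 := by
        intro m
        change π (k ^ m) = 1
        rw [map_pow, hk, one_pow]
      have ha : ∀ m : ℕ, (k ^ m).a = m • (k.a + f 1 1) - f 1 1 := by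
        intro m
        induction m with
        | zero => rw [pow_zero, one_a, zero_smul, zero_sub]
        | succ m ih =>
          rw [pow_succ, mul_a, ih, hg, hk', succ_nsmul]
          abel
      apply CE.ext
      · rw [ha, hA, zero_sub, one_a]
      · rw [hg, one_g])
  refine ⟨fun g => -(s g).a, fun g h => ?_⟩
  have h1 := congrArg CE.a (map_mul s g h)
  have hsg : ∀ g, (s g).g = g := hs
  rw [mul_a, hsg, hsg] at h1
  change f g h = -(s h).a - -(s (g * h)).a + -(s g).a
  rw [h1]
  abel

end
end SteinbergSL2

/-- `H²(SL₂(ℤ/ℓℤ), ℤ/pⁿℤ)` vanishes for the trivial action, where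
`ℓ ≠ p` are primes and `n ≥ 1`. -/
theorem h2_sl2_zmod_trivial_rep_subsingleton
    (ℓ p : ℕ) (hℓ : ℓ.Prime) (hp : p.Prime) (hne : ℓ ≠ p) (n : ℕ) (hn : 1 ≤ n) :
    Subsingleton
      (groupCohomology
        (Rep.trivial (ZMod (p ^ n)) (Matrix.SpecialLinearGroup (Fin 2) (ZMod ℓ))
          (ZMod (p ^ n))) 2) := by
  haveI : Fact ℓ.Prime := ⟨hℓ⟩
  refine subsingleton_of_forall_eq 0 fun x => ?_
  induction x using groupCohomology.H2_induction_on with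
  | h f =>
    rw [groupCohomology.H2π_eq_zero_iff]
    have hf := (groupCohomology.mem_cocycles₂_iff f.1).1 f.2
    obtain ⟨b, hb⟩ := SteinbergSL2.cocycle_split (A := ZMod (p ^ n)) ℓ (p ^ n)
      (((Nat.coprime_primes hp hℓ).2 hne.symm).pow_left n)
      (fun a => by rw [nsmul_eq_mul, ZMod.natCast_self, zero_mul])
      (fun g h => f (g, h)) (fun g h j => hf g h j)
    refine ⟨b, ?_⟩
    funext ⟨g, h⟩
    exact (hb g h).symm
end

section
/- Let L be an infinite field and let r, s be integers with 0 ≤ r ≤ s. For a polynomial P ∈ L[X₀, X₁, X₂, X₃], the following are equivalent: (i) for all a, d ∈ Lˣ and all b ∈ L, the algebra substitution X₀ ↦ aX₀ + bX₂, X₁ ↦ aX₁ + bX₃, X₂ ↦ dX₂, X₃ ↦ dX₃ sends P to aʳdˢ · P; (ii) P = (X₀X₃ − X₁X₂)ʳ · Q for some polynomial Q ∈ L[X₂, X₃] (involving only the variables X₂ and X₃) that is homogeneous of degree s − r. In particular, the L-vector space of polynomials satisfying (i) has dimension s − r + 1. -/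
open MvPolynomial

/-- The Borel substitution `X₀ ↦ aX₀ + bX₂, X₁ ↦ aX₁ + bX₃, X₂ ↦ dX₂, X₃ ↦ dX₃`. -/
noncomputable def borelSubst {L : Type} [Field L] (a d : Lˣ) (b : L) :
    Fin 4 → MvPolynomial (Fin 4) L :=
  ![C (a : L) * X 0 + C b * X 2,
    C (a : L) * X 1 + C b * X 3,
    C (d : L) * X 2,
    C (d : L) * X 3]

/-- The space of polynomials transforming by the character `aʳdˢ` under the Borel
substitution (the model for `Ind_B^{GL₂}(aʳ ⊗ dˢ)`). -/
noncomputable def borelSemiInvariants (L : Type) [Field L] (r s : ℕ) :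
    Submodule L (MvPolynomial (Fin 4) L) where
  carrier := {P | ∀ (a d : Lˣ) (b : L),
    aeval (borelSubst a d b) P = ((a : L) ^ r * (d : L) ^ s) • P}
  add_mem' := by
    intro P Q hP hQ a d b
    simp only [map_add, hP a d b, hQ a d b, smul_add]
  zero_mem' := by
    intro a d b
    simp
  smul_mem' := by
    intro c P hP a d b
    rw [map_smul, hP a d b, smul_comm]

/-- The span of the monomials `X₂ⁱX₃ⁿ⁻ⁱ`. -/
noncomputable def binarySpan (L : Type) [Field L] (n : ℕ) : Submodule L (MvPolynomial (Fin 4) L) :=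
  Submodule.span L (Set.range (fun i : Fin (n + 1) =>
    (X 2 ^ (i : ℕ) * X 3 ^ (n - i) : MvPolynomial (Fin 4) L)))

lemma mem_binarySpan {L : Type} [Field L] {n : ℕ} {Q : MvPolynomial (Fin 4) L}
    (hs : Q ∈ supported L ({2, 3} : Set (Fin 4))) (hh : Q.IsHomogeneous n) :
    Q ∈ binarySpan L n := by
  rw [Q.as_sum]
  refine Submodule.sum_mem _ fun m hm => ?_
  have hdeg : m 0 + m 1 + m 2 + m 3 = n := by
    have h := hh (mem_support_iff.mp hm)
    change Finsupp.weight (fun _ => 1) m = n at h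
    rw [← Finsupp.degree_eq_weight_one, Finsupp.degree_eq_sum, Fin.sum_univ_four] at h
    exact h
  rw [mem_supported] at hs
  have hz : ∀ i : Fin 4, i ∉ ({2, 3} : Set (Fin 4)) → m i = 0 := by
    intro i hi
    by_contra hne
    exact hi (hs (by
      simp only [Finset.mem_coe, mem_vars_iff_mem_support]
      exact ⟨m, hm, Finsupp.mem_support_iff.mpr hne⟩))
  have h0 : m 0 = 0 := hz 0 (by simp)
  have h1 : m 1 = 0 := hz 1 (by simp)
  have h3 : m 3 = n - m 2 := by omega
  have e : monomial m (coeff m Q) = coeff m Q • (X 2 ^ (m 2) * X 3 ^ (n - m 2)) := by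
    rw [monomial_eq, Finsupp.prod_fintype _ _ (by simp), Fin.prod_univ_four, h0, h1, h3,
      smul_eq_C_mul]
    simp
  rw [e]
  exact Submodule.smul_mem _ _ (Submodule.subset_span ⟨⟨m 2, by omega⟩, rfl⟩)

lemma linInd_binary (L : Type) [Field L] (n : ℕ) :
    LinearIndependent L (fun i : Fin (n + 1) =>
    (X 2 ^ (i : ℕ) * X 3 ^ (n - i) : MvPolynomial (Fin 4) L)) := by
  have h := (basisMonomials (Fin 4) L).linearIndependent.comp
    (fun i : Fin (n + 1) => Finsupp.single 2 (i : ℕ) + Finsupp.single 3 (n - (i : ℕ))) (by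
      intro i j hij
      have := DFunLike.congr_fun hij 2
      simp at this
      omega)
  have e : (fun i : Fin (n + 1) => (X 2 ^ (i : ℕ) * X 3 ^ (n - i) : MvPolynomial (Fin 4) L)) =
      basisMonomials (Fin 4) L ∘
      (fun i : Fin (n + 1) => Finsupp.single 2 (i : ℕ) + Finsupp.single 3 (n - (i : ℕ))) := by
    funext i
    simp [X_pow_eq_monomial, monomial_mul]
  rw [e]
  exact h

lemma mul_mem_semi {L : Type} [Field L] {r s : ℕ} (hrs : r ≤ s) {Q : MvPolynomial (Fin 4) L}
    (hQ : Q ∈ binarySpan L (s - r)) :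
    (X 0 * X 3 - X 1 * X 2) ^ r * Q ∈ borelSemiInvariants L r s := by
  suffices h : binarySpan L (s - r) ≤ (borelSemiInvariants L r s).comap
      (LinearMap.mulLeft L ((X 0 * X 3 - X 1 * X 2) ^ r)) from h hQ
  refine Submodule.span_le.mpr ?_
  rintro _ ⟨i, rfl⟩
  intro a d b
  have hi : (i : ℕ) + (s - r - i) + r = s := by omega
  have hD : aeval (borelSubst a d b) (X 0 * X 3 - X 1 * X 2 : MvPolynomial (Fin 4) L) =
      C (a : L) * C (d : L) * (X 0 * X 3 - X 1 * X 2) := by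
    simp [borelSubst]
    ring
  have h2 : aeval (borelSubst a d b) (X 2 : MvPolynomial (Fin 4) L) = C (d : L) * X 2 := by
    simp [borelSubst]
  have h3 : aeval (borelSubst a d b) (X 3 : MvPolynomial (Fin 4) L) = C (d : L) * X 3 := by
    simp [borelSubst]
  simp only [LinearMap.mulLeft_apply]
  rw [map_mul, map_mul, map_pow, map_pow, map_pow, hD, h2, h3, smul_eq_C_mul, map_mul, map_pow,
    map_pow]
  generalize s - r - i = k at hi ⊢
  have hs : (C (d : L) : MvPolynomial (Fin 4) L) ^ s = C (d : L) ^ ((i : ℕ) + k + r) := by rw [hi]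
  rw [hs, mul_pow _ (X 0 * X 3 - X 1 * X 2)]
  ring

lemma homog_of_scale {L : Type} [Field L] [Infinite L] {n : ℕ} {Q : MvPolynomial (Fin 4) L}
    (h : ∀ d : Lˣ, aeval (fun i => C (d : L) * X i) Q = (d : L) ^ n • Q) :
    Q.IsHomogeneous n := by
  intro m hm
  change Finsupp.weight (fun _ => 1) m = n
  rw [← Finsupp.degree_eq_weight_one]
  by_contra hne
  have key : ∀ d : Lˣ, (d : L) ^ m.degree = (d : L) ^ n := by
    intro d
    have h1 := congrArg (coeff m) (h d)
    have h2 : aeval (fun i => C (d : L) * X i) Q =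
        ∑ k ∈ Q.support, monomial k ((d : L) ^ k.degree * coeff k Q) := by
      conv_lhs => rw [Q.as_sum]
      rw [map_sum]
      refine Finset.sum_congr rfl fun k _ => ?_
      rw [aeval_monomial, Finsupp.prod_fintype _ _ (by simp), monomial_eq,
        Finsupp.prod_fintype _ _ (by simp)]
      simp only [mul_pow, Finset.prod_mul_distrib, Finset.prod_pow_eq_pow_sum, algebraMap_eq,
        Finsupp.degree_eq_sum, map_mul, map_pow]
      ring
    rw [h2, coeff_sum, coeff_smul] at h1
    simp only [coeff_monomial, Finset.sum_ite_eq', mem_support_iff, ne_eq, hm, not_false_eq_true,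
      if_true, smul_eq_mul] at h1
    exact mul_right_cancel₀ hm h1
  have hp : (Polynomial.X * (Polynomial.X ^ m.degree - Polynomial.X ^ n) : Polynomial L) = 0 := by
    refine Polynomial.funext fun x => ?_
    by_cases hx : x = 0
    · simp [hx]
    · have := key (Units.mk0 x hx)
      simp at this
      simp [this]
  have hp2 := sub_eq_zero.mp ((mul_eq_zero.mp hp).resolve_left Polynomial.X_ne_zero)
  have := congrArg Polynomial.natDegree hp2
  simp at this
  exact hne this

lemma semi_eval {L : Type} [Field L] {r s : ℕ} {P : MvPolynomial (Fin 4) L}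
    (hP : P ∈ borelSemiInvariants L r s) (a d : Lˣ) (b x y z t : L) :
    eval ![a * x + b * z, a * y + b * t, d * z, d * t] P =
      (a : L) ^ r * (d : L) ^ s * eval ![x, y, z, t] P := by
  have h := congrArg (eval ![x, y, z, t]) (hP a d b)
  rw [smul_eval] at h
  rw [← h, ← aeval_eq_eval, ← aeval_eq_eval]
  change _ = (aeval ![x, y, z, t]) ((aeval (borelSubst a d b)) P)
  rw [← AlgHom.comp_apply, comp_aeval]
  congr 2
  funext i
  fin_cases i <;> simp [borelSubst]

lemma semi_key {L : Type} [Field L] [Infinite L] {r s : ℕ} {P : MvPolynomial (Fin 4) L}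
    (hP : P ∈ borelSemiInvariants L r s) :
    X 2 ^ r * P = (X 1 * X 2 - X 0 * X 3) ^ r *
      aeval (![0, 1, X 2, X 3] : Fin 4 → MvPolynomial (Fin 4) L) P := by
  have hD0 : (X 1 * X 2 - X 0 * X 3 : MvPolynomial (Fin 4) L) ≠ 0 := by
    intro h
    have := congrArg (eval ![0, 1, 1, 0]) h
    simp at this
  have h0 : (X 2 * (X 1 * X 2 - X 0 * X 3) : MvPolynomial (Fin 4) L) ≠ 0 :=
    mul_ne_zero (X_ne_zero 2) hD0
  apply mul_left_cancel₀ h0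
  refine MvPolynomial.funext fun v => ?_
  obtain ⟨x, y, z, t, rfl⟩ : ∃ x y z t, v = ![x, y, z, t] :=
    ⟨v 0, v 1, v 2, v 3, by funext i; fin_cases i <;> rfl⟩
  have hR : eval ![x, y, z, t] (aeval (![0, 1, X 2, X 3] : Fin 4 → MvPolynomial (Fin 4) L) P) =
      eval ![0, 1, z, t] P := by
    rw [← aeval_eq_eval, ← aeval_eq_eval]
    change (aeval ![x, y, z, t]) ((aeval _) P) = _
    rw [← AlgHom.comp_apply, comp_aeval]
    congr 2
    funext i
    fin_cases i <;> simp
  simp only [map_mul, hR, map_sub, map_pow, eval_X, Matrix.cons_val]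
  by_cases hz : z = 0
  · simp [hz]
  by_cases hD : y * z - x * t = 0
  · simp [hD]
  congr 1
  have hu : (y * z - x * t) / z ≠ 0 := div_ne_zero hD hz
  have h := semi_eval hP (Units.mk0 _ hu) 1 (x / z) 0 1 z t
  simp only [Units.val_mk0, Units.val_one, one_pow, one_mul, mul_one, mul_zero, zero_add] at h
  have e1 : x / z * z = x := by field_simp
  have e2 : (y * z - x * t) / z + x / z * t = y := by field_simp; ring
  rw [e1, e2] at h
  rw [h, div_pow]
  field_simp

lemma semi_forward {L : Type} [Field L] [Infinite L] {r s : ℕ} (hrs : r ≤ s)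
    {P : MvPolynomial (Fin 4) L} (hP : P ∈ borelSemiInvariants L r s) :
    ∃ Q : MvPolynomial (Fin 4) L, Q ∈ supported L ({2, 3} : Set (Fin 4)) ∧
      Q.IsHomogeneous (s - r) ∧ P = (X 0 * X 3 - X 1 * X 2) ^ r * Q := by
  have key := semi_key hP
  set φ := aeval (R := L) (![0, 1, X 2, X 3] : Fin 4 → MvPolynomial (Fin 4) L) with hφ
  have hX : Prime (X 2 : MvPolynomial (Fin 4) L) := X_prime
  have hX0 : (X 2 ^ r : MvPolynomial (Fin 4) L) ≠ 0 := pow_ne_zero _ hX.ne_zero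
  have hnd : ¬ (X 2 : MvPolynomial (Fin 4) L) ∣ (X 1 * X 2 - X 0 * X 3) ^ r := by
    intro h
    obtain ⟨c, hc⟩ := hX.dvd_of_dvd_pow h
    have := congrArg (eval ![1, 0, 0, 1]) hc
    simp at this
  obtain ⟨R, hR⟩ := hX.pow_dvd_of_dvd_mul_left r hnd (Dvd.intro _ key)
  have hPR : P = (X 1 * X 2 - X 0 * X 3) ^ r * R := by
    apply mul_left_cancel₀ hX0
    rw [key, hR]
    ring
  have hidem : φ (φ P) = φ P := by
    rw [← AlgHom.comp_apply, hφ, comp_aeval]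
    congr 2
    funext i
    fin_cases i <;> simp
  have hRφ : R = φ R := by
    apply mul_left_cancel₀ hX0
    have h2 : φ (X 2) = X 2 := by simp [hφ]
    rw [← hR, ← hidem, hR, map_mul, map_pow, h2]
  have hRs : R ∈ supported L ({2, 3} : Set (Fin 4)) := by
    rw [hRφ]
    have : ∀ i, (![0, 1, X 2, X 3] : Fin 4 → MvPolynomial (Fin 4) L) i ∈
        supported L ({2, 3} : Set (Fin 4)) := by
      intro i
      fin_cases i
      · exact zero_mem _
      · exact one_mem _
      · exact X_mem_supported.mpr (by simp)
      · exact X_mem_supported.mpr (by simp)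
    rw [hφ, aeval_def, eval₂_eq]
    refine sum_mem fun m _ => mul_mem (Subalgebra.algebraMap_mem _ _)
      (prod_mem fun i _ => pow_mem (this i) _)
  have hRh : R.IsHomogeneous (s - r) := by
    refine homog_of_scale fun d => ?_
    have h := hP d d 0
    have hb : borelSubst d d (0 : L) = fun i => C (d : L) * X i := by
      funext i
      fin_cases i <;> simp [borelSubst]
    rw [hb, hPR, map_mul, map_pow] at h
    have hD : aeval (fun i => C (d : L) * X i) (X 1 * X 2 - X 0 * X 3 : MvPolynomial (Fin 4) L) =
        C (d : L) ^ 2 * (X 1 * X 2 - X 0 * X 3) := by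
      simp
      ring
    have hD0 : (X 1 * X 2 - X 0 * X 3 : MvPolynomial (Fin 4) L) ^ r ≠ 0 := by
      intro h
      exact hnd (h ▸ dvd_zero _)
    have hC : (C (d : L) : MvPolynomial (Fin 4) L) ^ (2 * r) ≠ 0 :=
      pow_ne_zero _ (by simp)
    apply mul_left_cancel₀ (mul_ne_zero hC hD0)
    rw [hD, smul_eq_C_mul, map_mul, map_pow, map_pow] at h
    rw [smul_eq_C_mul, map_pow]
    obtain ⟨k, rfl⟩ := Nat.exists_eq_add_of_le hrs
    rw [Nat.add_sub_cancel_left]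
    rw [mul_pow, ← pow_mul] at h
    rw [h]
    ring
  refine ⟨(-1) ^ r * R, mul_mem (pow_mem (neg_mem (one_mem _)) _) hRs, ?_, ?_⟩
  · have : ((-1) ^ r * R : MvPolynomial (Fin 4) L) = C ((-1) ^ r) * R := by simp
    rw [this]
    exact hRh.C_mul _
  · rw [hPR, ← mul_assoc, ← mul_pow]
    ring

/-- over an infinite field `L`, for `0 ≤ r ≤ s`, a polynomial
`P ∈ L[X₀,X₁,X₂,X₃]` transforms by `aʳdˢ` under the Borel substitution iff
`P = (X₀X₃ − X₁X₂)ʳ · Q` with `Q` a polynomial in `X₂, X₃` only, homogeneous of degree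
`s − r`; in particular the space of such `P` has dimension `s − r + 1`. -/
theorem borelSemiInvariants_characterization
    (L : Type) [Field L] [Infinite L] (r s : ℕ) (hrs : r ≤ s) :
    (∀ P : MvPolynomial (Fin 4) L,
      P ∈ borelSemiInvariants L r s ↔
        ∃ Q : MvPolynomial (Fin 4) L,
          Q ∈ supported L ({2, 3} : Set (Fin 4)) ∧
          Q.IsHomogeneous (s - r) ∧
          P = (X 0 * X 3 - X 1 * X 2) ^ r * Q) ∧
    Module.finrank L (borelSemiInvariants L r s) = s - r + 1 := by
  refine ⟨fun P => ⟨semi_forward hrs, ?_⟩, ?_⟩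
  · rintro ⟨Q, hs, hh, rfl⟩
    exact mul_mem_semi hrs (mem_binarySpan hs hh)
  · have hD0 : (X 0 * X 3 - X 1 * X 2 : MvPolynomial (Fin 4) L) ^ r ≠ 0 := by
      apply pow_ne_zero
      intro h
      have := congrArg (eval ![1, 0, 0, 1]) h
      simp at this
    have e : borelSemiInvariants L r s = (binarySpan L (s - r)).map
        (LinearMap.mulLeft L ((X 0 * X 3 - X 1 * X 2) ^ r)) := by
      ext P
      constructor
      · intro hP
        obtain ⟨Q, hs, hh, rfl⟩ := semi_forward hrs hP
        exact ⟨Q, mem_binarySpan hs hh, rfl⟩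
      · rintro ⟨Q, hQ, rfl⟩
        exact mul_mem_semi hrs hQ
    have hinj : Function.Injective
        (LinearMap.mulLeft L ((X 0 * X 3 - X 1 * X 2 : MvPolynomial (Fin 4) L) ^ r)) :=
      fun x y h => mul_left_cancel₀ hD0 h
    rw [e, ← (Submodule.equivMapOfInjective _ hinj _).finrank_eq, binarySpan,
      finrank_span_eq_card (linInd_binary L (s - r)), Fintype.card_fin]
end

section
/- Let GL₂(Ẑ) denote the topological group ∏_ℓ GL₂(ℤ_ℓ) (product over all primes ℓ, product topology), let p be a prime, and let f : GL₂(Ẑ) → ℚ_p be a continuous function that is invariant under left translation by SL₂(ℤ), i.e. f(γ · x) = f(x) for every γ ∈ SL₂(ℤ) (embedded diagonally) and every x ∈ GL₂(Ẑ). Then f(x) = f(y) whenever det x = det y in ∏_ℓ ℤ_ℓ; that is, f factors through the determinant map GL₂(Ẑ) → Ẑˣ. -/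
instance (q : Nat.Primes) : Fact (Nat.Prime (q : ℕ)) := ⟨q.2⟩

/-- `GL₂(Ẑ) = ∏_ℓ GL₂(ℤ_ℓ)`, with the product topology. -/
abbrev GL2Zhat : Type := ∀ q : Nat.Primes, GL (Fin 2) ℤ_[(q : ℕ)]

/-- The diagonal embedding `SL₂(ℤ) → GL₂(Ẑ)`. -/
noncomputable def sl2ZToGL2Zhat (γ : Matrix.SpecialLinearGroup (Fin 2) ℤ) : GL2Zhat :=
  fun q => Matrix.SpecialLinearGroup.toGL
    (Matrix.SpecialLinearGroup.map (Int.castRingHom ℤ_[(q : ℕ)]) γ)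

section Helpers
open Matrix

/-- upper unipotent -/
def upperU {R : Type*} [CommRing R] (a : R) : SpecialLinearGroup (Fin 2) R :=
  ⟨!![1, a; 0, 1], by simp⟩

/-- lower unipotent -/
def lowerU {R : Type*} [CommRing R] (a : R) : SpecialLinearGroup (Fin 2) R :=
  ⟨!![1, 0; a, 1], by simp⟩

theorem upperU_coe {R : Type*} [CommRing R] (a : R) :
    (upperU a : Matrix (Fin 2) (Fin 2) R) = !![1, a; 0, 1] := rfl

theorem lowerU_coe {R : Type*} [CommRing R] (a : R) :
    (lowerU a : Matrix (Fin 2) (Fin 2) R) = !![1, 0; a, 1] := rfl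

theorem sl2_decomp_unit {R : Type*} [CommRing R] (g : SpecialLinearGroup (Fin 2) R)
    (h : IsUnit (g 1 0)) : ∃ x c y : R, g = upperU x * lowerU c * upperU y := by
  obtain ⟨u, hu⟩ := h.exists_right_inv
  have hd := g.det_coe
  rw [Matrix.det_fin_two] at hd
  refine ⟨(g 0 0 - 1) * u, g 1 0, (g 1 1 - 1) * u, ?_⟩
  ext i j
  fin_cases i <;> fin_cases j <;>
    simp [upperU_coe, lowerU_coe, SpecialLinearGroup.coe_mul, Matrix.mul_apply, Fin.sum_univ_two] <;> grind

theorem sl2_decomp {R : Type*} [CommRing R] [IsLocalRing R]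
    (g : SpecialLinearGroup (Fin 2) R) :
    ∃ t x c y : R, g = lowerU t * (upperU x * lowerU c * upperU y) := by
  by_cases h : IsUnit (g 1 0)
  · obtain ⟨x, c, y, e⟩ := sl2_decomp_unit g h
    refine ⟨0, x, c, y, ?_⟩
    rw [← e]
    ext i j
    fin_cases i <;> fin_cases j <;> simp [lowerU_coe, Matrix.mul_apply, Fin.sum_univ_two]
  · have hd := g.det_coe
    rw [Matrix.det_fin_two] at hd
    have ha : IsUnit (g 0 0) := by
      have h1 : IsUnit (g 0 0 * g 1 1 + (- g 0 1) * g 1 0) := by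
        have : g 0 0 * g 1 1 + (- g 0 1) * g 1 0 = 1 := by linear_combination hd
        rw [this]; exact isUnit_one
      rcases IsLocalRing.isUnit_or_isUnit_of_isUnit_add h1 with h2 | h2
      · exact isUnit_of_mul_isUnit_left h2
      · exact absurd (isUnit_of_mul_isUnit_right h2) h
    have hs : IsUnit ((lowerU 1 * g : SpecialLinearGroup (Fin 2) R) 1 0) := by
      have e : (lowerU 1 * g : SpecialLinearGroup (Fin 2) R) 1 0 = g 0 0 + g 1 0 := by
        simp [lowerU_coe, Matrix.mul_apply, Fin.sum_univ_two]
      rw [e]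
      have h1 : IsUnit ((g 0 0 + g 1 0) + (- g 1 0)) := by simpa using ha
      rcases IsLocalRing.isUnit_or_isUnit_of_isUnit_add h1 with h2 | h2
      · exact h2
      · exact absurd (by simpa using h2) h
    obtain ⟨x, c, y, e⟩ := sl2_decomp_unit _ hs
    refine ⟨-1, x, c, y, ?_⟩
    rw [← e, ← mul_assoc]
    have : (lowerU (-1) * lowerU 1 : SpecialLinearGroup (Fin 2) R) = 1 := by
      ext i j
      fin_cases i <;> fin_cases j <;> simp [lowerU_coe, Matrix.mul_apply, Fin.sum_univ_two]
    rw [this, one_mul]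

theorem denseRange_int_Zhat :
    DenseRange (fun (n : ℤ) (q : Nat.Primes) => (n : ℤ_[(q : ℕ)])) := by
  classical
  intro a
  rw [mem_closure_iff_nhds]
  intro V hV
  rw [nhds_pi, Filter.mem_pi] at hV
  obtain ⟨I, hI, t, ht, hV⟩ := hV
  have hk : ∀ q : Nat.Primes, ∃ k : ℕ, ∀ z : ℤ_[(q : ℕ)],
      z - a q ∈ Ideal.span {((q : ℕ) : ℤ_[(q : ℕ)]) ^ k} → z ∈ t q := by
    intro q
    obtain ⟨ε, hε, hb⟩ := Metric.mem_nhds_iff.1 (ht q)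
    obtain ⟨k, hk⟩ := PadicInt.exists_pow_neg_lt (q : ℕ) hε
    refine ⟨k, fun z hz => hb ?_⟩
    rw [Metric.mem_ball, dist_eq_norm]
    exact lt_of_le_of_lt ((PadicInt.norm_le_pow_iff_mem_span_pow _ _).2 hz) hk
  choose k hk using hk
  obtain ⟨n, hn⟩ := Nat.chineseRemainderOfFinset (fun q : Nat.Primes => (a q).appr (k q))
    (fun q : Nat.Primes => (q : ℕ) ^ k q) hI.toFinset
    (fun q _ => pow_ne_zero _ q.2.ne_zero)
    (fun q _ r _ hqr => Nat.Coprime.pow _ _ ((Nat.coprime_primes q.2 r.2).2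
      (fun h => hqr (Subtype.ext h))))
  refine ⟨fun q => ((n : ℤ) : ℤ_[(q : ℕ)]), hV ?_, ⟨(n : ℤ), rfl⟩⟩
  intro q hq
  apply hk
  have h1 := hn q (hI.mem_toFinset.2 hq)
  have h2 := PadicInt.appr_spec (k q) (a q)
  have h3 : ((n : ℤ) : ℤ_[(q : ℕ)]) - ((a q).appr (k q) : ℤ_[(q : ℕ)])
      ∈ Ideal.span {((q : ℕ) : ℤ_[(q : ℕ)]) ^ (k q)} := by
    rw [Ideal.mem_span_singleton]
    have := (Nat.modEq_iff_dvd.1 h1.symm)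
    have := map_dvd (Int.castRingHom ℤ_[(q : ℕ)]) this
    simpa using this
  have := Ideal.sub_mem _ h3 h2
  simpa using this

theorem continuous_upperU_toGL {R : Type*} [CommRing R] [TopologicalSpace R]
    [IsTopologicalRing R] :
    Continuous (fun a : R => SpecialLinearGroup.toGL (upperU a)) := by
  rw [Units.continuous_iff]
  constructor
  · refine continuous_matrix fun i j => ?_
    fin_cases i <;> fin_cases j <;> simp [upperU_coe] <;> fun_prop
  · have e : ∀ a : R, (SpecialLinearGroup.toGL (upperU a))⁻¹ = SpecialLinearGroup.toGL (upperU (-a)) := by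
      intro a
      rw [inv_eq_iff_mul_eq_one, ← map_mul]
      have : (upperU a * upperU (-a) : SpecialLinearGroup (Fin 2) R) = 1 := by
        ext i j
        fin_cases i <;> fin_cases j <;> simp [upperU_coe, Matrix.mul_apply, Fin.sum_univ_two]
      rw [this, map_one]
    simp only [e]
    refine continuous_matrix fun i j => ?_
    fin_cases i <;> fin_cases j <;> simp [upperU_coe] <;> fun_prop

theorem continuous_lowerU_toGL {R : Type*} [CommRing R] [TopologicalSpace R]
    [IsTopologicalRing R] :
    Continuous (fun a : R => SpecialLinearGroup.toGL (lowerU a)) := by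
  rw [Units.continuous_iff]
  constructor
  · refine continuous_matrix fun i j => ?_
    fin_cases i <;> fin_cases j <;> simp [lowerU_coe] <;> fun_prop
  · have e : ∀ a : R, (SpecialLinearGroup.toGL (lowerU a))⁻¹ = SpecialLinearGroup.toGL (lowerU (-a)) := by
      intro a
      rw [inv_eq_iff_mul_eq_one, ← map_mul]
      have : (lowerU a * lowerU (-a) : SpecialLinearGroup (Fin 2) R) = 1 := by
        ext i j
        fin_cases i <;> fin_cases j <;> simp [lowerU_coe, Matrix.mul_apply, Fin.sum_univ_two]
      rw [this, map_one]
    simp only [e]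
    refine continuous_matrix fun i j => ?_
    fin_cases i <;> fin_cases j <;> simp [lowerU_coe] <;> fun_prop

/-- If a continuous family agrees with `SL₂(ℤ)` elements on integers, `f` is invariant under it. -/
theorem invariant_of_family {p : ℕ} [Fact p.Prime] (f : C(GL2Zhat, ℚ_[p]))
    (hf : ∀ γ : Matrix.SpecialLinearGroup (Fin 2) ℤ, ∀ x : GL2Zhat,
      f (sl2ZToGL2Zhat γ * x) = f x)
    (F : (∀ q : Nat.Primes, ℤ_[(q : ℕ)]) → GL2Zhat) (hF : Continuous F)
    (γ : ℤ → Matrix.SpecialLinearGroup (Fin 2) ℤ)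
    (hγ : ∀ n : ℤ, F (fun q => (n : ℤ_[(q : ℕ)])) = sl2ZToGL2Zhat (γ n))
    (a : ∀ q : Nat.Primes, ℤ_[(q : ℕ)]) (x : GL2Zhat) : f (F a * x) = f x := by
  have h : (fun a => f (F a * x)) = fun _ => f x := by
    refine denseRange_int_Zhat.equalizer ?_ continuous_const ?_
    · exact f.continuous.comp (hF.mul continuous_const)
    · funext n
      simp only [Function.comp]
      rw [hγ, hf]
  exact congrFun h a

end Helpers

theorem continuous_SL2Z_invariant_function_factors_through_det
    (p : ℕ) [Fact p.Prime] (f : C(GL2Zhat, ℚ_[p]))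
    (hf : ∀ γ : Matrix.SpecialLinearGroup (Fin 2) ℤ, ∀ x : GL2Zhat,
      f (sl2ZToGL2Zhat γ * x) = f x) :
    ∀ x y : GL2Zhat,
      (∀ q : Nat.Primes,
        ((x q : Matrix (Fin 2) (Fin 2) ℤ_[(q : ℕ)]).det
          = (y q : Matrix (Fin 2) (Fin 2) ℤ_[(q : ℕ)]).det)) →
      f x = f y := by
  intro x y hxy
  have hU := invariant_of_family f hf
    (fun a q => Matrix.SpecialLinearGroup.toGL (upperU (a q)))
    (continuous_pi fun q => continuous_upperU_toGL.comp (continuous_apply q)) upperU (by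
      intro n; funext q
      ext i j
      fin_cases i <;> fin_cases j <;> simp [sl2ZToGL2Zhat, upperU_coe])
  have hL := invariant_of_family f hf
    (fun a q => Matrix.SpecialLinearGroup.toGL (lowerU (a q)))
    (continuous_pi fun q => continuous_lowerU_toGL.comp (continuous_apply q)) lowerU (by
      intro n; funext q
      ext i j
      fin_cases i <;> fin_cases j <;> simp [sl2ZToGL2Zhat, lowerU_coe])
  have key : ∀ q : Nat.Primes, ∃ t u c v : ℤ_[(q : ℕ)],
      x q = Matrix.SpecialLinearGroup.toGL (lowerU t) *
        (Matrix.SpecialLinearGroup.toGL (upperU u) *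
        (Matrix.SpecialLinearGroup.toGL (lowerU c) *
        (Matrix.SpecialLinearGroup.toGL (upperU v) * y q))) := by
    intro q
    have hdet : ((x q * (y q)⁻¹ : GL (Fin 2) ℤ_[(q : ℕ)]) :
        Matrix (Fin 2) (Fin 2) ℤ_[(q : ℕ)]).det = 1 := by
      rw [Units.val_mul, Matrix.det_mul, hxy q, ← Matrix.det_mul, ← Units.val_mul,
        mul_inv_cancel, Units.val_one, Matrix.det_one]
    obtain ⟨t, u, c, v, e⟩ := sl2_decomp
      (⟨_, hdet⟩ : Matrix.SpecialLinearGroup (Fin 2) ℤ_[(q : ℕ)])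
    refine ⟨t, u, c, v, ?_⟩
    have e2 : x q * (y q)⁻¹ = Matrix.SpecialLinearGroup.toGL
        (⟨_, hdet⟩ : Matrix.SpecialLinearGroup (Fin 2) ℤ_[(q : ℕ)]) := by
      ext i j; rfl
    rw [e] at e2
    rw [mul_inv_eq_iff_eq_mul] at e2
    rw [e2]
    simp only [map_mul, mul_assoc]
  choose t u c v h using key
  have hx : x = (fun q => Matrix.SpecialLinearGroup.toGL (lowerU (t q))) *
        ((fun q => Matrix.SpecialLinearGroup.toGL (upperU (u q))) *
        ((fun q => Matrix.SpecialLinearGroup.toGL (lowerU (c q))) *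
        ((fun q => Matrix.SpecialLinearGroup.toGL (upperU (v q))) * y))) := by
    funext q
    exact h q
  rw [hx]
  exact (hL t _).trans ((hU u _).trans ((hL c _).trans (hU v _)))
end

section
/- Let k be a commutative ring in which 6 is invertible. Then for every k-linear representation M of SL₂(ℤ), the group cohomology Hⁿ(SL₂(ℤ), M) vanishes for every n ≥ 2. -/
namespace SL2ZCoh

set_option linter.unusedSectionVars false

open Matrix ModularGroup

/-- The order six generator. -/
def U : SpecialLinearGroup (Fin 2) ℤ := ⟨!![1, -1; 1, 0], by simp [Matrix.det_fin_two]⟩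

/-- Words in `su` and `suu`. -/
inductive Q {H : Type*} [Group H] (s u : H) : H → Prop
  | one : Q s u 1
  | su (w : H) : Q s u w → Q s u (s * (u * w))
  | suu (w : H) : Q s u w → Q s u (s * (u * (u * w)))

/-- Normal forms. -/
def NF {H : Type*} [Group H] (s u z : H) (h : H) : Prop :=
  ∃ e a w b, h = e * (a * (w * b)) ∧ (e = 1 ∨ e = z) ∧ (a = 1 ∨ a = u ∨ a = u * u) ∧
    Q s u w ∧ (b = 1 ∨ b = s)

section
variable {H : Type*} [Group H] {s u z : H} (hs : s * s = z) (hu : u * (u * u) = z)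
  (hz : z * z = 1)
include hs hu hz

lemma comm_sz : s * z = z * s := by rw [← hs, mul_assoc]
lemma comm_uz : u * z = z * u := by rw [← hu]; simp only [mul_assoc]

lemma nf_z {h : H} (hh : NF s u z h) : NF s u z (z * h) := by
  obtain ⟨e, a, w, b, rfl, he, ha, hw, hb⟩ := hh
  rcases he with rfl | rfl
  · exact ⟨z, a, w, b, by simp, by simp, ha, hw, hb⟩
  · exact ⟨1, a, w, b, by rw [← mul_assoc, hz], by simp, ha, hw, hb⟩

lemma nf_u {h : H} (hh : NF s u z h) : NF s u z (u * h) := by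
  obtain ⟨e, a, w, b, rfl, he, ha, hw, hb⟩ := hh
  have hc : u * (e * (a * (w * b))) = e * ((u * a) * (w * b)) := by
    rcases he with rfl | rfl
    · simp [mul_assoc]
    · rw [← mul_assoc, comm_uz hs hu hz]; simp [mul_assoc]
  rw [hc]
  rcases ha with rfl | rfl | rfl
  · exact ⟨e, u, w, b, by simp, he, by simp, hw, hb⟩
  · exact ⟨e, _, w, b, rfl, he, by simp, hw, hb⟩
  · rw [hu]
    have : e * (z * (w * b)) = z * (e * (1 * (w * b))) := by
      rcases he with rfl | rfl <;> simp
    rw [this]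
    exact nf_z hs hu hz ⟨e, 1, w, b, rfl, he, by simp, hw, hb⟩

lemma nf_s {h : H} (hh : NF s u z h) : NF s u z (s * h) := by
  obtain ⟨e, a, w, b, rfl, he, ha, hw, hb⟩ := hh
  have hc : s * (e * (a * (w * b))) = e * (s * (a * (w * b))) := by
    rcases he with rfl | rfl
    · simp
    · rw [← mul_assoc, comm_sz hs hu hz]; simp [mul_assoc]
  have key : NF s u z (s * (a * (w * b))) := by
    rcases ha with rfl | rfl | rfl
    · cases hw with
      | one =>
        rcases hb with rfl | rfl
        · exact ⟨1, 1, 1, s, by simp, by simp, by simp, Q.one, by simp⟩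
        · exact ⟨z, 1, 1, 1, by simp [hs], by simp, by simp, Q.one, by simp⟩
      | su w hw =>
        exact ⟨z, u, w, b, by rw [← hs]; simp [mul_assoc], by simp, by simp, hw, hb⟩
      | suu w hw =>
        exact ⟨z, u * u, w, b, by rw [← hs]; simp [mul_assoc], by simp, by simp, hw, hb⟩
    · exact ⟨1, 1, _, b, by simp [mul_assoc], by simp, by simp, Q.su w hw, hb⟩
    · exact ⟨1, 1, _, b, by simp [mul_assoc], by simp, by simp, Q.suu w hw, hb⟩
  rw [hc]
  rcases he with rfl | rfl
  · simpa using key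
  · exact nf_z hs hu hz key

lemma nf_closure {h : H} (hh : h ∈ Subgroup.closure {s, u}) : NF s u z h := by
  induction hh using Subgroup.closure_induction_left with
  | one => exact ⟨1, 1, 1, 1, by simp, by simp, by simp, Q.one, by simp⟩
  | mul_left x hx y hy ih =>
    rcases hx with rfl | rfl
    · exact nf_s hs hu hz ih
    · exact nf_u hs hu hz ih
  | inv_mul_cancel x hx y hy ih =>
    rcases hx with rfl | rfl
    · have : x⁻¹ = z * x := by
        rw [inv_eq_iff_mul_eq_one, ← mul_assoc, comm_sz hs hu hz, mul_assoc, hs, hz]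
      rw [this, mul_assoc]
      exact nf_z hs hu hz (nf_s hs hu hz ih)
    · have : x⁻¹ = z * (x * x) := by
        rw [inv_eq_iff_mul_eq_one, ← mul_assoc, comm_uz hs hu hz, mul_assoc, hu, hz]
      rw [this, mul_assoc, mul_assoc]
      exact nf_z hs hu hz (nf_u hs hu hz (nf_u hs hu hz ih))
end

lemma coeU : ((U : SpecialLinearGroup (Fin 2) ℤ) : Matrix (Fin 2) (Fin 2) ℤ) = !![1, -1; 1, 0] := rfl

lemma q_pos {H : Type*} [Group H] {s u : H} (p : H →* SpecialLinearGroup (Fin 2) ℤ)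
    (ps : p s = S) (pu : p u = U) {w : H} (hw : Q s u w) :
    ∃ ε a b c d : ℤ, (ε = 1 ∨ ε = -1) ∧
      (p w : Matrix (Fin 2) (Fin 2) ℤ) = !![ε * a, ε * b; ε * c, ε * d] ∧
      1 ≤ a ∧ 1 ≤ d ∧ b ≤ 0 ∧ c ≤ 0 ∧ (w = 1 ∧ ε = 1 ∨ b + c ≤ -1) := by
  induction hw with
  | one => 
    refine ⟨1, 1, 0, 0, 1, by simp, ?_, by simp, by simp, by simp, by simp, by simp⟩
    ext i j; fin_cases i <;> fin_cases j <;> simp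
  | su w hw ih =>
    obtain ⟨ε, a, b, c, d, he, hm, ha, hd, hb, hc, -⟩ := ih
    refine ⟨-ε, a, b, c - a, d - b, by omega, ?_, by omega, by omega, by omega, by omega,
      Or.inr (by omega)⟩
    simp only [map_mul, ps, pu, Matrix.SpecialLinearGroup.coe_mul, coe_S, coeU, hm]
    ext i j; fin_cases i <;> fin_cases j <;> simp [Matrix.mul_apply, Fin.sum_univ_two] <;> ring
  | suu w hw ih =>
    obtain ⟨ε, a, b, c, d, he, hm, ha, hd, hb, hc, -⟩ := ih
    refine ⟨-ε, a - c, b - d, c, d, by omega, ?_, by omega, by omega, by omega, by omega,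
      Or.inr (by omega)⟩
    simp only [map_mul, ps, pu, Matrix.SpecialLinearGroup.coe_mul, coe_S, coeU, hm]
    ext i j; fin_cases i <;> fin_cases j <;> simp [Matrix.mul_apply, Fin.sum_univ_two] <;> ring

theorem inj_closure {H : Type*} [Group H] {s u z : H} (hs : s * s = z) (hu : u * (u * u) = z)
    (hz : z * z = 1) (p : H →* SpecialLinearGroup (Fin 2) ℤ)
    (ps : p s = S) (pu : p u = U) {h : H} (hh : h ∈ Subgroup.closure {s, u}) (h1 : p h = 1) :
    h = 1 := by
  obtain ⟨e, a, w, b, rfl, he, ha, hw, hb⟩ := nf_closure hs hu hz hh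
  obtain ⟨ε, a', b', c', d', hε, hm, ha', hd', hb', hc', hw1⟩ := q_pos p ps pu hw
  have pz : p z = S * S := by rw [← hs, map_mul, ps]
  have h2 := congrArg (fun x : SpecialLinearGroup (Fin 2) ℤ => (x : Matrix (Fin 2) (Fin 2) ℤ)) h1
  simp only [map_mul, Matrix.SpecialLinearGroup.coe_mul, hm, Matrix.SpecialLinearGroup.coe_one] at h2
  have h00 := congrFun (congrFun h2 0) 0
  have h01 := congrFun (congrFun h2 0) 1
  have h10 := congrFun (congrFun h2 1) 0
  have h11 := congrFun (congrFun h2 1) 1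
  clear h2 h1 hm hh
  rcases he with rfl | rfl <;> rcases ha with rfl | rfl | rfl <;> rcases hb with rfl | rfl <;>
  rcases hε with rfl | rfl <;>
  simp [ps, pu, pz, coeU, coe_S, Matrix.mul_apply, Fin.sum_univ_two] at h00 h01 h10 h11 <;>
  first
  | (exfalso; omega)
  | (rcases hw1 with ⟨rfl, hw2⟩ | hw1
     · first | simp | (exfalso; omega)
     · exfalso; omega)

lemma closure_SU : Subgroup.closure {S, U} = ⊤ := by
  rw [eq_top_iff, ← SpecialLinearGroup.SL2Z_generators, Subgroup.closure_le]
  have hS : S ∈ Subgroup.closure {S, U} := Subgroup.subset_closure (by simp)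
  have hU : U ∈ Subgroup.closure {S, U} := Subgroup.subset_closure (by simp)
  have hT : T = U * (S * (S * S)) := by
    ext i j; fin_cases i <;> fin_cases j <;>
      simp [coe_T, coeU, coe_S, Matrix.mul_apply, Fin.sum_univ_two]
  rintro x (rfl | rfl)
  · exact hS
  · rw [hT]
    exact mul_mem hU (mul_mem hS (mul_mem hS hS))

end SL2ZCoh

namespace SL2ZCoh

open Matrix ModularGroup

/-- Pairs (vector, group element), with the affine group law. -/
@[ext] structure Aff {k G V : Type*} [CommRing k] [Group G] [AddCommGroup V] [Module k V]
    (ρ : Representation k G V) where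
  v : V
  g : G

namespace Aff
variable {k G V : Type*} [CommRing k] [Group G] [AddCommGroup V] [Module k V]
    {ρ : Representation k G V}

instance : Mul (Aff ρ) := ⟨fun x y => ⟨ρ x.g y.v + x.v, x.g * y.g⟩⟩
instance : One (Aff ρ) := ⟨⟨0, 1⟩⟩
instance : Inv (Aff ρ) := ⟨fun x => ⟨-ρ x.g⁻¹ x.v, x.g⁻¹⟩⟩

@[simp] lemma mul_v (x y : Aff ρ) : (x * y).v = ρ x.g y.v + x.v := rfl
@[simp] lemma mul_g (x y : Aff ρ) : (x * y).g = x.g * y.g := rfl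
@[simp] lemma one_v : (1 : Aff ρ).v = 0 := rfl
@[simp] lemma one_g : (1 : Aff ρ).g = 1 := rfl
@[simp] lemma inv_v (x : Aff ρ) : (x⁻¹).v = -ρ x.g⁻¹ x.v := rfl
@[simp] lemma inv_g (x : Aff ρ) : (x⁻¹).g = x.g⁻¹ := rfl

instance : Group (Aff ρ) where
  mul_assoc a b c := Aff.ext (by simp [add_assoc]) (by simp [mul_assoc])
  one_mul a := Aff.ext (by simp) (by simp)
  mul_one a := Aff.ext (by simp) (by simp)
  inv_mul_cancel a := Aff.ext (by simp) (by simp)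

/-- The projection. -/
def proj (ρ : Representation k G V) : Aff ρ →* G where
  toFun := g
  map_one' := rfl
  map_mul' _ _ := rfl
end Aff

lemma S_sq : S * S = -1 := by
  ext i j; fin_cases i <;> fin_cases j <;> simp [coe_S, Matrix.mul_apply, Fin.sum_univ_two]

lemma U_cube : U * (U * U) = -1 := by
  ext i j; fin_cases i <;> fin_cases j <;> simp [coeU, Matrix.mul_apply, Fin.sum_univ_two]

section
variable {k : Type*} [CommRing k] {B C : Type*} [AddCommGroup B] [AddCommGroup C]
  [Module k B] [Module k C]
  (ρB : Representation k (Matrix.SpecialLinearGroup (Fin 2) ℤ) B)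
  (ρC : Representation k (Matrix.SpecialLinearGroup (Fin 2) ℤ) C)
  (f : B →ₗ[k] C) (hf : ∀ g x, f (ρB g x) = ρC g (f x))
  (c : Matrix.SpecialLinearGroup (Fin 2) ℤ → C)
  (hc : ∀ g h, c (g * h) = ρC g (c h) + c g)
include hf hc

lemma lift_of_gens (bS bU : B) (hS : ρB S bS + bS = 0)
    (hU : ρB U (ρB U bU + bU) + bU = 0) (fS : f bS = c S) (fU : f bU = c U) :
    ∃ b : Matrix.SpecialLinearGroup (Fin 2) ℤ → B, (∀ g h, b (g * h) = ρB g (b h) + b g) ∧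
      ∀ g, f (b g) = c g := by
  let s : Aff ρB := ⟨bS, S⟩
  let u : Aff ρB := ⟨bU, U⟩
  let z : Aff ρB := ⟨0, -1⟩
  let p := Aff.proj ρB
  have hs : s * s = z := Aff.ext (by simpa [s, z] using hS) (by simp [s, z, S_sq])
  have hu : u * (u * u) = z := Aff.ext (by simpa [u, z] using hU) (by simp [u, z, U_cube])
  have hz : z * z = 1 := Aff.ext (by simp [z]) (by simp [z])
  have hinj : ∀ h ∈ Subgroup.closure {s, u}, p h = 1 → h = 1 := fun h hh h1 =>
    inj_closure hs hu hz p rfl rfl hh h1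
  have hsurj : ∀ g, ∃ h ∈ Subgroup.closure {s, u}, p h = g := by
    intro g
    have hg : g ∈ (Subgroup.closure {s, u}).map p := by
      rw [MonoidHom.map_closure, Set.image_pair]
      change g ∈ Subgroup.closure {S, U}
      rw [closure_SU]; trivial
    exact hg
  have c1 : c 1 = 0 := by simpa using hc 1 1
  have hfc : ∀ h ∈ Subgroup.closure {s, u}, f h.v = c h.g := by
    intro h hh
    induction hh using Subgroup.closure_induction with
    | mem x hx =>
      rcases hx with rfl | rfl
      · exact fS
      · exact fU
    | one => simp [c1]
    | mul x y _ _ hx hy => simp [hf, hc, hx, hy]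
    | inv x _ hx =>
      have := hc x.g⁻¹ x.g
      rw [inv_mul_cancel, c1] at this
      simp only [Aff.inv_v, Aff.inv_g, map_neg, hf, hx]
      exact (eq_neg_of_add_eq_zero_right this.symm).symm
  choose b hb hbp using hsurj
  have huniq : ∀ h ∈ Subgroup.closure {s, u}, b (p h) = h := by
    intro h hh
    have := hinj (b (p h) * h⁻¹) (mul_mem (hb _) (inv_mem hh)) (by simp [hbp])
    exact mul_inv_eq_one.mp this
  have hbg : ∀ g, (b g).g = g := hbp
  refine ⟨fun g => (b g).v, fun g h => ?_, fun g => ?_⟩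
  · have := huniq (b g * b h) (mul_mem (hb _) (hb _))
    rw [map_mul, hbp, hbp] at this
    simp [this, hbg]
  · rw [hfc _ (hb g), hbg]

theorem lift_cocycle (h6 : IsUnit (6 : k)) (hsurj : Function.Surjective f) :
    ∃ b : Matrix.SpecialLinearGroup (Fin 2) ℤ → B, (∀ g h, b (g * h) = ρB g (b h) + b g) ∧
      ∀ g, f (b g) = c g := by
  have c1 : c 1 = 0 := by simpa using hc 1 1
  obtain ⟨i6, hi6⟩ := h6.exists_left_inv
  -- first, the case where `c (-1) = 0`
  have main : ∀ c : Matrix.SpecialLinearGroup (Fin 2) ℤ → C,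
      (∀ g h, c (g * h) = ρC g (c h) + c g) → c (-1) = 0 →
      ∃ b : Matrix.SpecialLinearGroup (Fin 2) ℤ → B, (∀ g h, b (g * h) = ρB g (b h) + b g) ∧
      ∀ g, f (b g) = c g := by
    intro c hc cm
    have hB : ∀ g h x, ρB g (ρB h x) = ρB (g * h) x := by intros; simp
    have hSS : ∀ x, ρB S (ρB S x) = ρB (-1) x := by intro x; rw [hB, S_sq]
    have hUU : ∀ x, ρB U (ρB U (ρB U x)) = ρB (-1) x := by intro x; rw [hB, hB, mul_assoc, U_cube]
    have hmm : ∀ x, ρB (-1) (ρB (-1) x) = x := by intro x; rw [hB]; simp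
    have hmS : ∀ x, ρB S (ρB (-1) x) = ρB (-1) (ρB S x) := by intro x; rw [hB, hB]; simp
    have hmU : ∀ x, ρB U (ρB (-1) x) = ρB (-1) (ρB U x) := by intro x; rw [hB, hB]; simp
    have cS : ρC S (c S) = - c S := by
      have := hc S S
      rw [S_sq, cm] at this
      exact eq_neg_of_add_eq_zero_left this.symm
    have cU : ρC U (ρC U (c U)) = - ρC U (c U) - c U := by
      have := hc U (U * U)
      rw [U_cube, cm, hc, map_add] at this
      rw [sub_eq_add_neg, ← neg_add, eq_neg_iff_add_eq_zero, ← add_assoc, ← this]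
    have cmg : ∀ g, ρC (-1) (c g) = c g := by
      intro g
      have h1 := hc (-1) g
      have h2 := hc g (-1)
      rw [cm] at h1 h2
      simp only [map_zero, add_zero, zero_add, mul_neg, mul_one, neg_mul, one_mul] at h1 h2
      rw [← h1, h2]
    obtain ⟨x, hx⟩ := hsurj (c S)
    obtain ⟨y, hy⟩ := hsurj (c U)
    have h4 : (9 * i6 * i6) * 4 = (1 : k) := by linear_combination (6 * i6 + 1) * hi6
    refine lift_of_gens ρB ρC f hf c hc
      ((9 * i6 * i6) • (x - ρB S x + ρB (-1) x - ρB (-1) (ρB S x)))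
      (i6 • ((2 : k) • (y + ρB (-1) y) - ρB U (y + ρB (-1) y) - ρB U (ρB U (y + ρB (-1) y))))
      ?_ ?_ ?_ ?_
    · simp only [map_smul, map_sub, map_add, hSS, hmS, hmm]
      module
    · simp only [map_smul, map_sub, map_add, hUU, hmU, hmm]
      module
    · simp only [map_smul, map_sub, map_add, hf, hx, cS, cmg, map_neg]
      calc _ = ((9 * i6 * i6) * 4) • c S := by module
        _ = _ := by rw [h4, one_smul]
    · simp only [map_smul, map_sub, map_add, hf, hy, cU, cmg, map_neg]
      calc _ = (i6 * 6) • c U := by module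
        _ = _ := by rw [hi6, one_smul]
  have h2 : (3 * i6) * 2 = (1 : k) := by linear_combination hi6
  have hcm : ρC (-1) (c (-1)) = - c (-1) := by
    have := hc (-1) (-1)
    simp only [mul_neg, mul_one, neg_neg, c1] at this
    exact eq_neg_of_add_eq_zero_left this.symm
  obtain ⟨x, hx⟩ := hsurj (-((3 * i6) • c (-1)))
  obtain ⟨b, hb, hfb⟩ := main (fun g => c g - (ρC g (f x) - f x))
    (by intro g h; simp only [hc, map_mul, Module.End.mul_apply, map_sub]; abel)
    (by
      simp only [hx, map_neg, map_smul, hcm]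
      calc _ = (1 - (3 * i6) * 2) • c (-1) := by module
        _ = _ := by rw [h2, sub_self, zero_smul])
  refine ⟨fun g => b g + (ρB g x - x), ?_, ?_⟩
  · intro g h; simp only [hb, map_mul, Module.End.mul_apply, map_sub, map_add]; abel
  · intro g; simp only [map_add, map_sub, hf, hfb]; abel
end

end SL2ZCoh

namespace SL2ZCoh
open CategoryTheory Limits groupCohomology

/-- The embedding of a representation into a coinduced one. -/
noncomputable def emb {k G : Type} [CommRing k] [Group G] (M : Rep.{0} k G) :
    M ⟶ Rep.coind (⊥ : Subgroup G).subtype (Rep.res (⊥ : Subgroup G).subtype M) :=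
  Rep.resCoindHomEquiv.{0} _ _ _ (𝟙 _)

lemma emb_mono {k G : Type} [CommRing k] [Group G] (M : Rep.{0} k G) : Mono (emb M) := by
  rw [Rep.mono_iff_injective]
  intro x y hxy
  have h : M.ρ 1 x = M.ρ 1 y := congrFun (congrArg Subtype.val hxy) 1
  simpa using h

lemma coind_isZero {k G : Type} [CommRing k] [Group G] (M : Rep.{0} k G) (n : ℕ) :
    IsZero (groupCohomology
      (Rep.coind (⊥ : Subgroup G).subtype (Rep.res (⊥ : Subgroup G).subtype M)) (n + 1)) :=
  (isZero_groupCohomology_succ_of_subsingleton _ n).of_iso (coindIso _ _)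

lemma emb_shortExact {k G : Type} [CommRing k] [Group G] (M : Rep.{0} k G) :
    (ShortComplex.mk (emb M) (cokernel.π (emb M)) (cokernel.condition _)).ShortExact :=
  haveI := emb_mono M
  { exact := ShortComplex.exact_cokernel _
    mono_f := inferInstance
    epi_g := by dsimp; infer_instance }

theorem vanish (k : Type) [CommRing k] (h6 : IsUnit (6 : k)) (n : ℕ) :
    ∀ M : Rep.{0} k (Matrix.SpecialLinearGroup (Fin 2) ℤ),
      Subsingleton (groupCohomology M (n + 2)) := by
  induction n with
  | zero =>
    intro M
    have hX := emb_shortExact M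
    haveI : Epi (δ hX 1 2 rfl) := epi_δ_of_isZero hX 1 (coind_isZero M 1)
    have hs := (ModuleCat.epi_iff_surjective (δ hX 1 2 rfl)).1 inferInstance
    suffices h : ∀ x : groupCohomology M 2, x = 0 from ⟨fun a b => by rw [h a, h b]⟩
    intro x
    obtain ⟨y, rfl⟩ := hs x
    induction y using H1_induction_on with | _ z
    have hg := (Rep.epi_iff_surjective (cokernel.π (emb M))).1 inferInstance
    obtain ⟨b, hb, hbz⟩ := lift_cocycle _ _ (cokernel.π (emb M)).hom.toLinearMap
      (fun g x => Rep.hom_comm_apply (cokernel.π (emb M)) g x) z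
      ((mem_cocycles₁_iff _).1 z.2) h6 hg
    rw [δ₁_apply hX z b (funext hbz) 0]
    · exact (H2π_eq_zero_iff _).2 (zero_mem _)
    · have : b ∈ cocycles₁ _ := (mem_cocycles₁_iff (A := Rep.coind _ _) b).2 hb
      rw [show d₁₂ _ b = 0 from this]
      funext g
      exact map_zero _
  | succ n ih =>
    intro M
    have hX := emb_shortExact M
    haveI : Epi (δ hX (n + 2) (n + 2 + 1) rfl) := epi_δ_of_isZero hX (n + 2) (coind_isZero M (n + 2))
    have hs := (ModuleCat.epi_iff_surjective (δ hX (n + 2) (n + 2 + 1) rfl)).1 inferInstance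
    haveI := ih (cokernel (emb M))
    exact hs.subsingleton

end SL2ZCoh


/-- if `6` is invertible in the commutative ring `k`, then for every `k`-linear
representation `M` of `SL₂(ℤ)`, the group cohomology `Hⁿ(SL₂(ℤ), M)` vanishes for `n ≥ 2`. -/
theorem groupCohomology_SL2Z_subsingleton_of_isUnit_six
    (k : Type) [CommRing k] (h6 : IsUnit (6 : k))
    (M : Rep k (Matrix.SpecialLinearGroup (Fin 2) ℤ)) (n : ℕ) (hn : 2 ≤ n) :
    Subsingleton (groupCohomology M n) := by
  obtain ⟨m, rfl⟩ := Nat.exists_eq_add_of_le' hn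
  exact SL2ZCoh.vanish k h6 m M
end
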